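/- arXiv:2404.09944 — 4 statements merged into one kernel-verified Lean document; each statement's English description precedes it below -/
import Mathlib

section
/- If 0 < λ < 1, ū ∈ (0, 1/2), and a > ln(2/λ)/ū, then the mean-field model has an interior fixed point below ū: there exists u_− ∈ (0, ū) with φ_{λ,a}(u_−) = 0. In particular, for λ < 1 the basin of attraction of the extinction state 0 can be made arbitrarily small by taking a large positive. -/
/-- Mean-field vector field of the contact process with density-dependent birth rate. -/
noncomputable def phi (lam a u : ℝ) : ℝ := lam * Real.exp (a * u) * u * (1 - u) - u

/-- For `0 < λ < 1`, `ū ∈ (0, 1/2)` and payoff `a > ln(2/λ)/ū`, the mean-field model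
has an interior fixed point `u₋ ∈ (0, ū)`: the basin of attraction of the extinction
state can be made arbitrarily small by taking `a` large positive. -/
theorem interior_fixed_point_below (lam : ℝ) (hlam0 : 0 < lam) (hlam1 : lam < 1)
    (ubar : ℝ) (h0 : 0 < ubar) (h2 : ubar < 1 / 2) (a : ℝ)
    (ha : a > Real.log (2 / lam) / ubar) :
    ∃ uminus ∈ Set.Ioo 0 ubar, phi lam a uminus = 0 := by
  have hexp : 2 / lam < Real.exp (a * ubar) := by
    have h : Real.log (2 / lam) < a * ubar := (div_lt_iff₀ h0).1 ha
    exact (Real.log_lt_iff_lt_exp (by positivity)).1 h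
  have h3 : 2 < lam * Real.exp (a * ubar) := by
    have := (div_lt_iff₀ hlam0).1 hexp
    linarith
  have hc : ContinuousOn (fun u : ℝ => lam * Real.exp (a * u) * (1 - u) - 1)
      (Set.Icc 0 ubar) := by fun_prop
  have hm : (0 : ℝ) ∈ Set.Ioo (lam * Real.exp (a * 0) * (1 - 0) - 1)
      (lam * Real.exp (a * ubar) * (1 - ubar) - 1) := by
    constructor
    · simp only [mul_zero, Real.exp_zero]
      linarith
    · nlinarith
  obtain ⟨u, hu, hu0⟩ := intermediate_value_Ioo h0.le hc hm
  refine ⟨u, hu, ?_⟩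
  have hu1 : lam * Real.exp (a * u) * (1 - u) - 1 = 0 := hu0
  unfold phi
  linear_combination u * hu1
end

section
/- If λ > 0, ū ∈ (0, 1/2), and a > ln(2/λ)/ū, then the mean-field model has an interior fixed point above ū: since φ_{λ,a}(ū) > 0 and φ_{λ,a}(1) = −1 < 0, there exists u_+ ∈ (ū, 1) with φ_{λ,a}(u_+) = 0. -/
/-- For `λ > 0`, `ū ∈ (0, 1/2)` and payoff `a > ln(2/λ)/ū`, since `φ_{λ,a}(ū) > 0`
and `φ_{λ,a}(1) = −1 < 0`, the mean-field model has an interior fixed point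
`u₊ ∈ (ū, 1)`. -/
theorem interior_fixed_point_above (lam : ℝ) (hlam : 0 < lam) (ubar : ℝ)
    (h0 : 0 < ubar) (h2 : ubar < 1 / 2) (a : ℝ) (ha : a > Real.log (2 / lam) / ubar) :
    ∃ uplus ∈ Set.Ioo ubar 1, phi lam a uplus = 0 := by
  have h1 : 2 < lam * Real.exp (a * ubar) := by
    have h : Real.log (2 / lam) < a * ubar := (div_lt_iff₀ h0).1 ha
    have h' := (Real.log_lt_iff_lt_exp (by positivity)).1 h
    rw [div_lt_iff₀ hlam] at h'
    linarith
  have hpos : 0 < phi lam a ubar := by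
    unfold phi
    have h3 : 0 < ubar * (1 - ubar) := mul_pos h0 (by linarith)
    have h4 := mul_lt_mul_of_pos_right h1 h3
    nlinarith
  have hneg : phi lam a 1 < 0 := by
    unfold phi
    norm_num
  have hc : ContinuousOn (phi lam a) (Set.Icc ubar 1) := by
    unfold phi
    fun_prop
  obtain ⟨u, hu, h⟩ := intermediate_value_Ioo' (by linarith) hc ⟨hneg, hpos⟩
  exact ⟨u, hu, h⟩
end

section
/- If λ > 1, ū ∈ (0, 1/2), and a < ln(1/λ)/ū, then there exists u_+ ∈ (0, ū) with φ_{λ,a}(u_+) = 0. In particular, for λ > 1 the population survives in the mean-field model, but starting at low density it converges to a limit that can be made arbitrarily small by taking a large negative. -/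
/-- For `λ > 1`, `ū ∈ (0, 1/2)` and payoff `a < ln(1/λ)/ū`, the mean-field model has
a fixed point `u₊ ∈ (0, ū)`: the population survives but the limiting density can be
made arbitrarily small by taking `a` large negative. -/
theorem small_interior_fixed_point (lam : ℝ) (hlam : 1 < lam) (ubar : ℝ)
    (h0 : 0 < ubar) (h2 : ubar < 1 / 2) (a : ℝ) (ha : a < Real.log (1 / lam) / ubar) :
    ∃ uplus ∈ Set.Ioo 0 ubar, phi lam a uplus = 0 := by
  have hc : ContinuousOn (fun u : ℝ => lam * Real.exp (a * u) * (1 - u)) (Set.Icc 0 ubar) := by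
    fun_prop
  have hlt : lam * Real.exp (a * ubar) < 1 := by
    rw [lt_div_iff₀ h0] at ha
    have h := Real.exp_lt_exp.mpr ha
    rw [Real.exp_log (by positivity), lt_div_iff₀ (by linarith)] at h
    linarith
  have hpos : 0 < lam * Real.exp (a * ubar) := by positivity
  have hm := intermediate_value_Ioo' h0.le hc
  obtain ⟨u, hu, hu1⟩ := hm (show (1 : ℝ) ∈ _ from
    ⟨by show lam * Real.exp (a * ubar) * (1 - ubar) < 1; nlinarith, by simpa using hlam⟩)
  refine ⟨u, hu, ?_⟩
  have hu1 : lam * Real.exp (a * u) * (1 - u) = 1 := hu1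
  unfold phi
  linear_combination u * hu1
end

section
/- Suppose λ ∈ (0, 1), a > 0, u₀ ∈ (0, 1), φ_{λ,a}(u₀) = 0, and the derivative of φ_{λ,a} at u₀ is 0. Then a·u₀ is the unique positive solution x_λ of λ·e^{x} = 1 + x, u₀ = x_λ/(1 + x_λ), and the payoff satisfies a = 1 + x_λ; equivalently a·(1 − u₀) = 1. In particular, the critical payoff of the bistable regime of the mean-field model is a_c(λ) = 1 + x_λ. -/
/-- If `λ ∈ (0, 1)`, `a > 0` and `u₀ ∈ (0, 1)` is an interior tangency point of the
mean-field model (`φ_{λ,a}(u₀) = 0` and `φ_{λ,a}'(u₀) = 0`), then `a·u₀` is the unique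
positive solution `x_λ` of `λ·e^x = 1 + x`, `u₀ = x_λ/(1 + x_λ)`, the payoff satisfies
`a = 1 + x_λ` (equivalently `a·(1 − u₀) = 1`): the critical payoff of the bistable
regime is `a_c(λ) = 1 + x_λ`. -/
theorem critical_payoff (lam : ℝ) (hlam0 : 0 < lam) (hlam1 : lam < 1) (a : ℝ)
    (ha : 0 < a) (u₀ : ℝ) (hu₀ : u₀ ∈ Set.Ioo (0 : ℝ) 1) (hfix : phi lam a u₀ = 0)
    (hderiv : HasDerivAt (phi lam a) 0 u₀) :
    (0 < a * u₀ ∧ lam * Real.exp (a * u₀) = 1 + a * u₀) ∧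
    (∀ x : ℝ, 0 < x → lam * Real.exp x = 1 + x → x = a * u₀) ∧
    u₀ = (a * u₀) / (1 + a * u₀) ∧ a = 1 + a * u₀ ∧ a * (1 - u₀) = 1 := by
  obtain ⟨h0, h1⟩ := hu₀
  have hd : HasDerivAt (phi lam a)
      ((lam * (Real.exp (a * u₀) * (a * 1)) * u₀ + lam * Real.exp (a * u₀) * 1) * (1 - u₀)
        + lam * Real.exp (a * u₀) * u₀ * (-1) - 1) u₀ := by
    have hid := hasDerivAt_id' u₀
    exact (((((hid.const_mul a).exp).const_mul lam).mul hid).mul (hid.const_sub 1)).sub hid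
  have hE := hd.unique hderiv
  unfold phi at hfix
  generalize hEx : lam * Real.exp (a * u₀) = E at *
  have e1 : E * (1 - u₀) = 1 := by
    apply mul_left_cancel₀ h0.ne'
    linarith
  have e2 : lam * (Real.exp (a * u₀) * (a * 1)) = E * a := by rw [← hEx]; ring
  rw [e2] at hE
  have e3 : E = a := by
    apply mul_left_cancel₀ h0.ne'
    linear_combination (a * u₀) * e1 - hE + e1
  subst e3
  have e4 : E = 1 + E * u₀ := by linarith
  have hpos : 0 < E * u₀ := mul_pos ha h0
  have key : ∀ x y : ℝ, 0 < x → lam * Real.exp x = 1 + x → lam * Real.exp y = 1 + y →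
      ¬ x < y := by
    intro x y hx hx1 hy1 hxy
    have t := Real.add_one_le_exp (y - x)
    have hy2 : lam * Real.exp y = (1 + x) * Real.exp (y - x) := by
      rw [← hx1, mul_assoc, ← Real.exp_add]; congr 2; ring
    nlinarith [mul_pos hx (sub_pos.2 hxy)]
  have hsol : lam * Real.exp (E * u₀) = 1 + E * u₀ := hEx.trans e4
  refine ⟨⟨hpos, by linarith⟩, ?_, ?_, e4, e1⟩
  · intro x hx hx1
    exact le_antisymm (not_lt.1 (key _ _ hpos hsol hx1)) (not_lt.1 (key _ _ hx hx1 hsol))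
  · rw [← e4]; field_simp
end
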